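/- arXiv:1205.1003 — 9 statements merged into one kernel-verified Lean document; each statement's English description precedes it below -/
import Mathlib

section
/- Let M ∈ SL(2,ℤ) and let n ≥ 1 be an integer. Then the reduction of M modulo n is conjugate to its inverse within the group GL(2, ℤ/nℤ), i.e. there exists A ∈ GL(2, ℤ/nℤ) such that A·M·A⁻¹ ≡ M⁻¹ (mod n). -/
open Finset in
/-- The set of prime divisors of an integer can be prescribed among the primes dividing `n`. -/
theorem exists_int_prime_dvd_iff {n : ℕ} (hn : n ≠ 0) (P : ℕ → Prop) :
    ∃ s : ℤ, ∀ p : ℕ, p.Prime → p ∣ n → ((p : ℤ) ∣ s ↔ P p) := by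
  classical
  refine ⟨(∏ q ∈ n.primeFactors with P q, q : ℕ), fun p hp hpn => ?_⟩
  rw [Int.natCast_dvd_natCast, hp.prime.dvd_finsetProd_iff]
  constructor
  · rintro ⟨q, hq, hpq⟩
    obtain ⟨hq, hPq⟩ := mem_filter.1 hq
    rwa [(Nat.prime_dvd_prime_iff_eq hp (Nat.prime_of_mem_primeFactors hq)).1 hpq]
  · intro hP
    exact ⟨p, mem_filter.2 ⟨Nat.mem_primeFactors.2 ⟨hp, hpn, hn⟩, hP⟩, dvd_rfl⟩

/-- A primitive binary quadratic form over `ℤ` represents an integer coprime to a given `n ≠ 0`. -/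
theorem exists_binary_quadratic_form_coprime {a b c : ℤ} {n : ℕ} (hn : n ≠ 0)
    (h : ∀ p : ℕ, p.Prime → (p : ℤ) ∣ a → (p : ℤ) ∣ b → ¬ (p : ℤ) ∣ c) :
    ∃ s t : ℤ, IsCoprime (a * s ^ 2 + b * (s * t) + c * t ^ 2) (n : ℤ) := by
  obtain ⟨s, hs⟩ := exists_int_prime_dvd_iff hn fun q => ¬ (q : ℤ) ∣ c
  obtain ⟨t, ht⟩ := exists_int_prime_dvd_iff hn fun q => (q : ℤ) ∣ c ∧ ¬ (q : ℤ) ∣ a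
  refine ⟨s, t, ?_⟩
  rw [Int.isCoprime_iff_gcd_eq_one]
  refine Nat.Coprime.symm (Nat.coprime_of_dvd fun p hp hpn hpv => ?_)
  rw [Int.natAbs_natCast] at hpn
  rw [← Int.natCast_dvd] at hpv
  replace hs := hs p hp hpn
  replace ht := ht p hp hpn
  have hp' : Prime (p : ℤ) := Nat.prime_iff_prime_int.1 hp
  by_cases hc : (p : ℤ) ∣ c
  · have hs' : ¬ (p : ℤ) ∣ s := fun h => hs.1 h hc
    by_cases ha : (p : ℤ) ∣ a
    · have ht' : ¬ (p : ℤ) ∣ t := fun h => (ht.1 h).2 ha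
      have hb : (p : ℤ) ∣ b * (s * t) := by
        rw [dvd_add_left (hc.mul_right _), dvd_add_right (ha.mul_right _)] at hpv
        exact hpv
      rcases hp'.dvd_or_dvd hb with hb | hst
      · exact h p hp ha hb hc
      · exact (hp'.dvd_or_dvd hst).elim hs' ht'
    · have htd : (p : ℤ) ∣ t := ht.2 ⟨hc, ha⟩
      rw [dvd_add_left (hc.mul_right _), dvd_add_left ((htd.mul_left _).mul_left _)] at hpv
      exact (hp'.dvd_or_dvd hpv).elim ha fun h => hs' (hp'.dvd_of_dvd_pow h)
  · have hsd : (p : ℤ) ∣ s := hs.2 hc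
    have ht' : ¬ (p : ℤ) ∣ t := fun h => hc (ht.1 h).1
    rw [dvd_add_right (dvd_add ((dvd_pow hsd two_ne_zero).mul_left _)
      ((hsd.mul_right _).mul_left _))] at hpv
    exact (hp'.dvd_or_dvd hpv).elim hc fun h => ht' (hp'.dvd_of_dvd_pow h)

/-- The integral plane orthogonal to `(u, v, w)` contains a vector `(x, y, z)` at which
`x ^ 2 + y * z` is coprime to a given `n ≠ 0`. -/
theorem exists_orthogonal_coprime (u v w : ℤ) {n : ℕ} (hn : n ≠ 0) :
    ∃ x y z : ℤ, u * x + v * y + w * z = 0 ∧ IsCoprime (x ^ 2 + y * z) (n : ℤ) := by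
  obtain ⟨f, hf, hf1⟩ := Finset.extract_gcd ![u, v, w] (Finset.univ_nonempty (α := Fin 3))
  generalize Finset.univ.gcd ![u, v, w] = g at hf
  have hu : u = g * f 0 := hf 0 (Finset.mem_univ _)
  have hv : v = g * f 1 := hf 1 (Finset.mem_univ _)
  have hw : w = g * f 2 := hf 2 (Finset.mem_univ _)
  obtain ⟨s, t, hst⟩ := exists_binary_quadratic_form_coprime
      (a := f 1 ^ 2) (b := 2 * (f 1 * f 2) + f 0 ^ 2) (c := f 2 ^ 2) hn (by
    intro p hp h1 h0 h2
    have hp' : Prime (p : ℤ) := Nat.prime_iff_prime_int.1 hp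
    replace h1 := hp'.dvd_of_dvd_pow h1
    replace h2 := hp'.dvd_of_dvd_pow h2
    rw [dvd_add_right ((h1.mul_right _).mul_left _)] at h0
    replace h0 := hp'.dvd_of_dvd_pow h0
    refine hp'.not_dvd_one (hf1 ▸ Finset.dvd_gcd fun i _ => ?_)
    fin_cases i <;> assumption)
  refine ⟨s * f 1 + t * f 2, -(s * f 0), -(t * f 0), ?_, ?_⟩
  · rw [hu, hv, hw]
    ring
  · convert hst using 1
    ring

/-- A traceless invertible `2 × 2` matrix `A` with `A * M` traceless conjugates `M`, of
determinant one, to its inverse. -/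
theorem Matrix.conj_eq_inv_of_traceless {R : Type*} [CommRing R] {M : Matrix (Fin 2) (Fin 2) R}
    (hM : M.det = 1) {x y z : R} (hA : IsUnit !![x, y; z, -x].det)
    (h : (M 0 0 - M 1 1) * x + M 1 0 * y + M 0 1 * z = 0) :
    !![x, y; z, -x] * M * !![x, y; z, -x]⁻¹ = M⁻¹ := by
  have hinv : M⁻¹ = M.adjugate := by simp [Matrix.inv_def, hM]
  have hcomm : !![x, y; z, -x] * M = M⁻¹ * !![x, y; z, -x] := by
    rw [hinv, Matrix.adjugate_fin_two]
    ext i j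
    fin_cases i <;> fin_cases j <;> simp [Matrix.mul_apply, Fin.sum_univ_two] <;> grind
  rw [hcomm, Matrix.mul_nonsing_inv_cancel_right _ _ hA]

/-- Let `M ∈ SL(2,ℤ)` and let `n ≥ 1`. Then the reduction of `M` modulo `n`
is conjugate to its inverse within `GL(2, ℤ/nℤ)`: there is an invertible matrix `A` over
`ℤ/nℤ` with `A ⬝ M ⬝ A⁻¹ = M⁻¹` (all taken mod `n`). -/
theorem sl2_conjugate_to_inverse_mod_n
    (M : Matrix (Fin 2) (Fin 2) ℤ) (hM : M.det = 1) (n : ℕ) (hn : 1 ≤ n) :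
    ∃ A : Matrix (Fin 2) (Fin 2) (ZMod n), IsUnit A.det ∧
      A * M.map (Int.cast : ℤ → ZMod n) * A⁻¹ = (M.map (Int.cast : ℤ → ZMod n))⁻¹ := by
  obtain ⟨x, y, z, hxyz, hcop⟩ := exists_orthogonal_coprime (M 0 0 - M 1 1) (M 1 0) (M 0 1)
    (Nat.one_le_iff_ne_zero.1 hn)
  have hA : IsUnit !![(x : ZMod n), y; z, -x].det := by
    have hunit : IsUnit ((x ^ 2 + y * z : ℤ) : ZMod n) := by
      have := hcop.map (Int.castRingHom (ZMod n))
      simpa [isCoprime_zero_right] using this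
    convert hunit.neg using 1
    rw [Matrix.det_fin_two_of]
    push_cast
    ring
  refine ⟨_, hA, Matrix.conj_eq_inv_of_traceless ?_ hA ?_⟩
  · have := congrArg (Int.cast : ℤ → ZMod n) hM
    simpa [Matrix.det_fin_two] using this
  · simpa using congrArg (Int.cast : ℤ → ZMod n) hxyz
end

section
/- Let M ∈ SL(2,ℤ) with mgcd(M) ≠ 0. Then for every integer n ≥ 1 there exists an involution R ∈ GL(2, ℤ/nℤ) (i.e. R² ≡ 𝟙 mod n) such that R·M·R⁻¹ ≡ M⁻¹ (mod n). -/
/-- The matrix gcd of a `2 × 2` integer matrix `M = [[a,b],[c,d]]`: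
`mgcd M = gcd(b, c, d − a)`. -/
def mgcd (M : Matrix (Fin 2) (Fin 2) ℤ) : ℕ :=
  Int.gcd (M 0 1) (Int.gcd (M 1 0) (M 1 1 - M 0 0))

/-- A primitive binary quadratic form represents an integer coprime to any given `n ≠ 0`. -/
theorem exists_isCoprime_binary_quadratic_form {A B C : ℤ}
    (hprim : ∀ p : ℕ, p.Prime → ¬ ((p : ℤ) ∣ A ∧ (p : ℤ) ∣ B ∧ (p : ℤ) ∣ C))
    (n : ℕ) (hn : n ≠ 0) :
    ∃ x y : ℤ, IsCoprime (n : ℤ) (A * x ^ 2 + B * x * y + C * y ^ 2) := by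
  induction n using Nat.recOnPosPrimePosCoprime with
  | zero => exact absurd rfl hn
  | one => exact ⟨0, 0, by simpa using isCoprime_one_left⟩
  | prime_pow p k hp _ =>
    have hp' : Prime (p : ℤ) := Nat.prime_iff_prime_int.mp hp
    suffices ∃ x y : ℤ, ¬ (p : ℤ) ∣ A * x ^ 2 + B * x * y + C * y ^ 2 by
      obtain ⟨x, y, h⟩ := this
      refine ⟨x, y, ?_⟩
      push_cast
      exact (hp'.coprime_iff_not_dvd.mpr h).pow_left
    by_contra! h
    have hA : (p : ℤ) ∣ A := by simpa using h 1 0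
    have hC : (p : ℤ) ∣ C := by simpa using h 0 1
    have hB : (p : ℤ) ∣ B := by
      have h11 := (h 1 1).sub (hA.add hC)
      ring_nf at h11
      exact h11
    exact hprim p hp ⟨hA, hB, hC⟩
  | coprime a b _ _ hab iha ihb =>
    obtain ⟨x₁, y₁, h₁⟩ := iha (by omega)
    obtain ⟨x₂, y₂, h₂⟩ := ihb (by omega)
    obtain ⟨s, t, hst⟩ := Nat.isCoprime_iff_coprime.mpr hab
    refine ⟨x₂ * (s * a) + x₁ * (t * b), y₂ * (s * a) + y₁ * (t * b), ?_⟩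
    push_cast
    have key : ∀ {m x y x' y' : ℤ}, x' ≡ x [ZMOD m] → y' ≡ y [ZMOD m] →
        IsCoprime m (A * x ^ 2 + B * x * y + C * y ^ 2) →
        IsCoprime m (A * x' ^ 2 + B * x' * y' + C * y' ^ 2) := by
      intro m x y x' y' hx hy h
      obtain ⟨k, hk⟩ := (((hx.pow 2).mul_left A).add ((hx.mul_left B).mul hy)).add
        ((hy.pow 2).mul_left C) |>.symm.dvd
      rw [sub_eq_iff_eq_add'.mp hk]
      exact h.add_mul_left_right k
    have crt_left : ∀ u v : ℤ, v * (s * a) + u * (t * b) ≡ u [ZMOD a] := fun u v =>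
      (Int.modEq_iff_dvd.mpr ⟨(u - v) * s, by linear_combination -u * hst⟩)
    have crt_right : ∀ u v : ℤ, v * (s * a) + u * (t * b) ≡ v [ZMOD b] := fun u v =>
      (Int.modEq_iff_dvd.mpr ⟨(v - u) * t, by linear_combination -v * hst⟩)
    exact (key (crt_left _ _) (crt_left _ _) h₁).mul_left
      (key (crt_right _ _) (crt_right _ _) h₂)

/-- A trace-zero matrix `R` of determinant `-1` such that `R * M` also has trace zero
is an involution conjugating `M` to its inverse, whenever `det M = 1`. -/
theorem involution_and_conj_eq_inv {A : Type*} [CommRing A] {a b c d e f h : A}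
    (hdet : a * d - b * c = 1) (hR : e ^ 2 + f * h = 1)
    (htr : e * (a - d) + f * c + h * b = 0) :
    !![e, f; h, -e] * !![e, f; h, -e] = 1 ∧
      !![e, f; h, -e] * !![a, b; c, d] * !![e, f; h, -e]⁻¹ = !![a, b; c, d]⁻¹ := by
  have hinv : !![e, f; h, -e] * !![e, f; h, -e] = 1 := by
    rw [Matrix.mul_fin_two, Matrix.one_fin_two]
    congr! 3 <;> grind
  refine ⟨hinv, ?_⟩
  rw [Matrix.inv_eq_left_inv hinv, eq_comm]
  apply Matrix.inv_eq_left_inv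
  rw [Matrix.mul_assoc, Matrix.mul_fin_two, Matrix.mul_fin_two, Matrix.one_fin_two]
  ext i j
  fin_cases i <;> fin_cases j <;> simp <;> grind

/-- Let `M ∈ SL(2,ℤ)` with `mgcd(M) ≠ 0`. Then for every `n ≥ 1` there is an
involution `R ∈ GL(2, ℤ/nℤ)` (i.e. `R² = 𝟙` mod `n`) with `R ⬝ M ⬝ R⁻¹ = M⁻¹` mod `n`. -/
theorem sl2_involutory_reversor_mod_n
    (M : Matrix (Fin 2) (Fin 2) ℤ) (hM : M.det = 1) (hmgcd : mgcd M ≠ 0)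
    (n : ℕ) (hn : 1 ≤ n) :
    ∃ R : Matrix (Fin 2) (Fin 2) (ZMod n), R * R = 1 ∧
      R * M.map (Int.cast : ℤ → ZMod n) * R⁻¹ = (M.map (Int.cast : ℤ → ZMod n))⁻¹ := by
  obtain ⟨β, hβ⟩ : (mgcd M : ℤ) ∣ M 0 1 := Int.gcd_dvd_left _ _
  have hg : (mgcd M : ℤ) ∣ (Int.gcd (M 1 0) (M 1 1 - M 0 0) : ℤ) := Int.gcd_dvd_right _ _
  obtain ⟨γ, hγ⟩ : (mgcd M : ℤ) ∣ M 1 0 := hg.trans (Int.gcd_dvd_left _ _)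
  obtain ⟨δ, hδ⟩ : (mgcd M : ℤ) ∣ M 1 1 - M 0 0 := hg.trans (Int.gcd_dvd_right _ _)
  have hprim : ∀ p : ℕ, p.Prime → ¬ ((p : ℤ) ∣ γ ∧ (p : ℤ) ∣ δ ∧ (p : ℤ) ∣ -β) := by
    rintro p hp ⟨h₁, h₂, h₃⟩
    have hdvd : (mgcd M : ℤ) * p ∣ mgcd M := by
      refine Int.dvd_coe_gcd ?_ (Int.dvd_coe_gcd ?_ ?_)
      · rw [hβ]; exact mul_dvd_mul_left _ (dvd_neg.mp h₃)
      · rw [hγ]; exact mul_dvd_mul_left _ h₁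
      · rw [hδ]; exact mul_dvd_mul_left _ h₂
    have hle := Nat.le_of_dvd (Nat.pos_of_ne_zero hmgcd) (by exact_mod_cast hdvd)
    have := hp.two_le
    have := Nat.pos_of_ne_zero hmgcd
    nlinarith
  obtain ⟨x, y, hxy⟩ := exists_isCoprime_binary_quadratic_form hprim n (by omega)
  obtain ⟨u, v, huv⟩ := hxy
  have hv : (v : ZMod n) * (γ * x ^ 2 + δ * x * y - β * y ^ 2) = 1 := by
    have := congrArg (Int.cast : ℤ → ZMod n) huv
    push_cast at this
    rw [ZMod.natCast_self] at this
    linear_combination this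
  have hmap : M.map (Int.cast : ℤ → ZMod n) =
      !![(M 0 0 : ZMod n), (M 0 1 : ZMod n); (M 1 0 : ZMod n), (M 1 1 : ZMod n)] :=
    Matrix.eta_fin_two _
  have hdet : (M 0 0 : ZMod n) * M 1 1 - M 0 1 * M 1 0 = 1 := by
    rw [Matrix.det_fin_two] at hM
    exact_mod_cast congrArg (Int.cast : ℤ → ZMod n) hM
  have hβ' := congrArg (Int.cast : ℤ → ZMod n) hβ
  have hγ' := congrArg (Int.cast : ℤ → ZMod n) hγ
  have hδ' := congrArg (Int.cast : ℤ → ZMod n) hδ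
  push_cast at hβ' hγ' hδ'
  rw [hmap]
  refine ⟨_, involution_and_conj_eq_inv (A := ZMod n)
    (e := v * (γ * x ^ 2 + β * y ^ 2)) (f := v * (δ * x ^ 2 - 2 * β * x * y))
    (h := v * (2 * γ * x * y + δ * y ^ 2)) hdet ?_ ?_⟩
  · linear_combination (v * (γ * x ^ 2 + δ * x * y - β * y ^ 2) + 1 : ZMod n) * hv
  · linear_combination (-(v * (γ * x ^ 2 + β * y ^ 2)) : ZMod n) * hδ' +
      (v * (δ * x ^ 2 - 2 * β * x * y) : ZMod n) * hγ' +
      (v * (2 * γ * x * y + δ * y ^ 2) : ZMod n) * hβ'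
end

section
/- Let p be a prime and M ∈ GL(2, F_p). Then M is conjugate to M⁻¹ within the group GL(2, F_p) if and only if M² = 𝟙 or det(M) = 1. -/
namespace Matrix

variable {K : Type*} [Field K]

/-- Every `2 × 2` matrix over a field is intertwined with its adjugate by an invertible matrix. -/
theorem exists_mul_eq_adjugate_mul_fin_two (M : Matrix (Fin 2) (Fin 2) K) :
    ∃ A : Matrix (Fin 2) (Fin 2) K, A.det ≠ 0 ∧ A * M = M.adjugate * A := by
  obtain ⟨a, b, c, d, rfl⟩ : ∃ a b c d, M = !![a, b; c, d] := ⟨_, _, _, _, eta_fin_two M⟩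
  suffices h : ∃ x y z : K, x * x + y * z ≠ 0 ∧ x * (a - d) + y * c + z * b = 0 by
    obtain ⟨x, y, z, hdet, hrel⟩ := h
    refine ⟨!![x, y; z, -x], ?_, ?_⟩
    · rw [det_fin_two_of]
      contrapose! hdet
      linear_combination -hdet
    · rw [adjugate_fin_two_of, mul_fin_two, mul_fin_two]
      congrm !![?_, ?_; ?_, ?_]
      · linear_combination hrel
      · ring
      · ring
      · linear_combination hrel
  by_cases hb : b = 0
  · by_cases hc : c = 0
    · exact ⟨0, 1, 1, by simp, by simp [hb, hc]⟩
    · exact ⟨1, -(a - d) / c, 0, by simp, by field_simp; ring⟩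
  · exact ⟨1, 0, -(a - d) / b, by simp, by field_simp; ring⟩

theorem trace_adjugate_fin_two {R : Type*} [CommRing R] (M : Matrix (Fin 2) (Fin 2) R) :
    M.adjugate.trace = M.trace := by
  simp [adjugate_fin_two, trace_fin_two, add_comm]

/-- A traceless `2 × 2` matrix squares to the scalar `-det M`. -/
theorem sq_eq_neg_det_smul_one_of_trace_eq_zero {R : Type*} [CommRing R]
    {M : Matrix (Fin 2) (Fin 2) R} (h : M.trace = 0) : M ^ 2 = -M.det • 1 := by
  rw [trace_fin_two] at h
  ext i j
  fin_cases i <;> fin_cases j <;> simp [sq, mul_apply, Fin.sum_univ_two, det_fin_two]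
  · linear_combination M 0 0 * h
  · linear_combination M 0 1 * h
  · linear_combination M 1 0 * h
  · linear_combination M 1 1 * h

namespace GeneralLinearGroup

theorem coe_inv_eq_adjugate_of_det_eq_one {n : Type*} [Fintype n] [DecidableEq n]
    {M : GL n K} (h : (M : Matrix n n K).det = 1) :
    ((M⁻¹ : GL n K) : Matrix n n K) = (M : Matrix n n K).adjugate := by
  rw [coe_units_inv, inv_def, h, Ring.inverse_one, one_smul]

theorem exists_conj_eq_inv_of_det_eq_one {M : GL (Fin 2) K}
    (h : (M : Matrix (Fin 2) (Fin 2) K).det = 1) :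
    ∃ A : GL (Fin 2) K, A * M * A⁻¹ = M⁻¹ := by
  obtain ⟨A, hA, hAM⟩ := exists_mul_eq_adjugate_mul_fin_two (M : Matrix (Fin 2) (Fin 2) K)
  refine ⟨mkOfDetNeZero A hA, ?_⟩
  rw [mul_inv_eq_iff_eq_mul]
  apply Units.ext
  rw [Units.val_mul, Units.val_mul, coe_inv_eq_adjugate_of_det_eq_one h]
  exact hAM

theorem sq_eq_one_or_det_eq_one_of_conj_eq_inv {M A : GL (Fin 2) K}
    (h : A * M * A⁻¹ = M⁻¹) :
    M ^ 2 = 1 ∨ (M : Matrix (Fin 2) (Fin 2) K).det = 1 := by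
  by_cases hone : (M : Matrix (Fin 2) (Fin 2) K).det = 1
  · exact .inr hone
  left
  have hconj := congrArg (Units.val : GL (Fin 2) K → Matrix (Fin 2) (Fin 2) K) h
  rw [Units.val_mul, Units.val_mul, coe_units_inv M] at hconj
  have hdet := congrArg Matrix.det hconj
  rw [det_units_conj, det_nonsing_inv, Ring.inverse_eq_inv'] at hdet
  have hneg : (M : Matrix (Fin 2) (Fin 2) K).det = -1 :=
    (mul_self_eq_one_iff.mp ((mul_eq_one_iff_eq_inv₀ M.det_ne_zero).mpr hdet)).resolve_left hone
  have htrace := congrArg trace hconj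
  rw [trace_units_conj, inv_def, hneg, Ring.inverse_eq_inv', trace_smul, trace_adjugate_fin_two,
    inv_neg_one, neg_one_smul, eq_neg_iff_add_eq_zero, ← two_mul] at htrace
  have htwo : (2 : K) ≠ 0 := fun h2 => hone (by linear_combination hneg - h2)
  apply Units.ext
  rw [Units.val_pow_eq_pow_val, sq_eq_neg_det_smul_one_of_trace_eq_zero
    ((mul_eq_zero.mp htrace).resolve_left htwo), hneg, neg_neg, one_smul, Units.val_one]

end GeneralLinearGroup

end Matrix

/-- Let `p` be a prime and `M ∈ GL(2, 𝔽_p)`. Then `M` is conjugate to `M⁻¹`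
within `GL(2, 𝔽_p)` if and only if `M² = 𝟙` or `det M = 1`. -/
theorem gl2_reversible_iff_involution_or_det_one
    (p : ℕ) (hp : p.Prime) (M : GL (Fin 2) (ZMod p)) :
    (∃ A : GL (Fin 2) (ZMod p), A * M * A⁻¹ = M⁻¹) ↔
      (M ^ 2 = 1 ∨ (M : Matrix (Fin 2) (Fin 2) (ZMod p)).det = 1) := by
  have : Fact p.Prime := ⟨hp⟩
  constructor
  · rintro ⟨A, hA⟩
    exact Matrix.GeneralLinearGroup.sq_eq_one_or_det_eq_one_of_conj_eq_inv hA
  · rintro (h | h)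
    · exact ⟨1, by rw [one_mul, inv_one, mul_one, eq_inv_iff_mul_eq_one, ← sq, h]⟩
    · exact Matrix.GeneralLinearGroup.exists_conj_eq_inv_of_det_eq_one h
end

section
/- Let p be a prime and M ∈ GL(2, F_p) with det(M) = 1 and M² ≠ 𝟙. Then there exists an involution R ∈ GL(2, F_p) (i.e. R² = 𝟙) such that R·M·R⁻¹ = M⁻¹. -/
/-- Every `2 × 2` matrix over a field is conjugate to its adjugate by a matrix squaring to `1`. -/
theorem Matrix.exists_mul_self_eq_one_mul_mul_eq_adjugate {K : Type*} [Field K]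
    (A : Matrix (Fin 2) (Fin 2) K) :
    ∃ R : Matrix (Fin 2) (Fin 2) K, R * R = 1 ∧ R * A * R = A.adjugate := by
  obtain ⟨a, b, c, d, rfl⟩ : ∃ a b c d, A = !![a, b; c, d] := ⟨_, _, _, _, A.eta_fin_two⟩
  by_cases hb : b = 0
  · by_cases hc : c = 0
    · exact ⟨!![0, 1; 1, 0], by simp [Matrix.one_fin_two],
        by simp [Matrix.adjugate_fin_two, hb, hc]⟩
    · refine ⟨!![1, (d - a) / c; 0, -1], by simp [Matrix.one_fin_two], ?_⟩
      ext i j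
      fin_cases i <;> fin_cases j <;> simp [Matrix.adjugate_fin_two, hb] <;> field_simp <;> ring
  · refine ⟨!![1, 0; (d - a) / b, -1], by simp [Matrix.one_fin_two], ?_⟩
    ext i j
    fin_cases i <;> fin_cases j <;> simp [Matrix.adjugate_fin_two] <;> field_simp <;> ring

/-- Let `p` be a prime and `M ∈ GL(2, 𝔽_p)` with `det M = 1` and `M² ≠ 𝟙`.
Then there is an involution `R ∈ GL(2, 𝔽_p)` with `R ⬝ M ⬝ R⁻¹ = M⁻¹`. -/
theorem gl2_det_one_involutory_reversor
    (p : ℕ) (hp : p.Prime) (M : GL (Fin 2) (ZMod p))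
    (hdet : (M : Matrix (Fin 2) (Fin 2) (ZMod p)).det = 1) (hM : M ^ 2 ≠ 1) :
    ∃ R : GL (Fin 2) (ZMod p), R ^ 2 = 1 ∧ R * M * R⁻¹ = M⁻¹ := by
  have := Fact.mk hp
  obtain ⟨R, hR, hRM⟩ := Matrix.exists_mul_self_eq_one_mul_mul_eq_adjugate
    (M : Matrix (Fin 2) (Fin 2) (ZMod p))
  refine ⟨⟨R, R, hR, hR⟩, Units.ext (by simpa [sq] using hR), eq_inv_of_mul_eq_one_left ?_⟩
  refine Units.ext ?_
  change R * M * R * M = 1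
  rw [hRM, Matrix.adjugate_mul, hdet, one_smul]
end

section
/- Let M ∈ Mat(d,ℤ) be a matrix that is not of finite order (M^k ≠ 𝟙 for all k ≥ 1), let p be a prime not dividing det(M), and write M^{ord(M,p)} = 𝟙 + p^s·B with s ≥ 1 and an integer matrix B whose reduction mod p is nonzero. If p is odd or s ≥ 2, then ord(M, p^i) = ord(M, p) for all 1 ≤ i ≤ s, and ord(M, p^{s+i}) = p^i · ord(M, p^s) for all i ≥ 1. -/
/-- The order of the integer matrix `M` modulo `n`: the smallest `m ≥ 1` with
`M ^ m ≡ 𝟙 (mod n)` (and `0` if no such `m` exists, by convention of `sInf`). -/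
noncomputable def matOrd {d : ℕ} (M : Matrix (Fin d) (Fin d) ℤ) (n : ℕ) : ℕ :=
  sInf {m : ℕ | 0 < m ∧ (M ^ m).map (Int.cast : ℤ → ZMod n) = 1}

lemma matOrd_eq_orderOf {d : ℕ} (M : Matrix (Fin d) (Fin d) ℤ) (n : ℕ) :
    matOrd M n = orderOf ((Int.castRingHom (ZMod n)).mapMatrix M) := by
  have key (m : ℕ) : (M ^ m).map (Int.cast : ℤ → ZMod n) = 1 ↔
      (Int.castRingHom (ZMod n)).mapMatrix M ^ m = 1 := by
    rw [← map_pow]; rfl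
  simp only [matOrd, key]
  set x := (Int.castRingHom (ZMod n)).mapMatrix M
  by_cases hx : IsOfFinOrder x
  · refine le_antisymm (Nat.sInf_le ⟨hx.orderOf_pos, pow_orderOf_eq_one x⟩) ?_
    exact le_csInf ⟨_, hx.orderOf_pos, pow_orderOf_eq_one x⟩
      fun m hm ↦ orderOf_le_of_pow_eq_one hm.1 hm.2
  · rw [orderOf_eq_zero hx, Nat.sInf_eq_zero]
    refine .inr (Set.eq_empty_of_forall_notMem fun m hm ↦ hx ?_)
    exact isOfFinOrder_iff_pow_eq_one.2 ⟨m, hm⟩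

lemma Matrix.map_intCast_eq_zero_iff {m n : Type*} (A : Matrix m n ℤ) (k : ℕ) :
    A.map (Int.cast : ℤ → ZMod k) = 0 ↔ ∃ C : Matrix m n ℤ, A = (k : ℤ) • C := by
  constructor
  · intro h
    have hdvd (i j) : (k : ℤ) ∣ A i j :=
      (ZMod.intCast_zmod_eq_zero_iff_dvd _ _).1 (congrFun (congrFun h i) j)
    choose C hC using hdvd
    exact ⟨Matrix.of C, by ext i j; simpa using hC i j⟩
  · rintro ⟨C, rfl⟩
    ext i j
    simp

lemma matOrd_dvd_iff {d : ℕ} (M : Matrix (Fin d) (Fin d) ℤ) (n k : ℕ) :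
    matOrd M n ∣ k ↔ ∃ C : Matrix (Fin d) (Fin d) ℤ, M ^ k = 1 + (n : ℤ) • C := by
  rw [matOrd_eq_orderOf, orderOf_dvd_iff_pow_eq_one, ← map_pow, ← sub_eq_zero,
    ← map_one (Int.castRingHom (ZMod n)).mapMatrix, ← map_sub]
  refine (Matrix.map_intCast_eq_zero_iff (M ^ k - 1) n).trans ?_
  simp only [sub_eq_iff_eq_add']

lemma matOrd_dvd_matOrd {d : ℕ} (M : Matrix (Fin d) (Fin d) ℤ) {n k : ℕ} (h : n ∣ k) :
    matOrd M n ∣ matOrd M k := by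
  obtain ⟨C, hC⟩ := (matOrd_dvd_iff M k _).1 dvd_rfl
  obtain ⟨l, rfl⟩ := h
  exact (matOrd_dvd_iff M n _).2 ⟨(l : ℤ) • C, by rw [hC, smul_smul]; push_cast; rfl⟩

lemma exists_one_add_pow_eq {R : Type*} [Ring R] (x : R) (n : ℕ) :
    ∃ c : R, (1 + x) ^ n = 1 + n • x + n.choose 2 • x ^ 2 + x ^ 3 * c := by
  induction n with
  | zero => exact ⟨0, by simp⟩
  | succ n ih =>
    obtain ⟨c, hc⟩ := ih
    refine ⟨c * (1 + x) + (n.choose 2 : R), ?_⟩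
    rw [pow_succ, hc, Nat.choose_succ_succ' n 1, Nat.choose_one_right]
    simp only [nsmul_eq_mul, Nat.cast_add, Nat.cast_one, ← (Nat.cast_commute _ (x ^ 3)).eq, mul_add]
    noncomm_ring

/-- Raising `1 + p ^ t • B` to the `p`-th power increases the exponent of `p` by exactly one. -/
lemma exists_one_add_prime_pow_smul_pow {R : Type*} [Ring R] {p : ℕ} (hp : p.Prime) {t : ℕ}
    (ht : 1 ≤ t) (hcase : Odd p ∨ 2 ≤ t) (B : R) :
    ∃ C : R, (1 + ((p : ℤ) ^ t) • B) ^ p = 1 + ((p : ℤ) ^ (t + 1)) • (B + (p : ℤ) • C) := by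
  obtain ⟨c, hc⟩ := exists_one_add_pow_eq (((p : ℤ) ^ t) • B) p
  obtain ⟨a, ha⟩ : (p : ℤ) ^ (t + 2) ∣ (p.choose 2 : ℤ) * (p : ℤ) ^ (t * 2) := by
    rcases hcase with h | h
    · have h2 : 2 < p := hp.two_le.lt_of_ne (by rintro rfl; exact absurd h (by decide))
      obtain ⟨b, hb⟩ := hp.dvd_choose_self two_ne_zero h2
      obtain ⟨r, rfl⟩ := Nat.exists_eq_add_of_le ht
      exact ⟨b * p ^ r, by rw [hb]; push_cast; ring⟩
    · exact (pow_dvd_pow _ (by lia)).mul_left _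
  obtain ⟨b, hb⟩ : (p : ℤ) ^ (t + 2) ∣ (p : ℤ) ^ (t * 3) := pow_dvd_pow _ (by lia)
  refine ⟨a • B ^ 2 + b • (B ^ 3 * c), ?_⟩
  rw [hc, smul_pow, smul_pow, ← pow_mul, ← pow_mul, hb, smul_mul_assoc, ← natCast_zsmul,
    ← natCast_zsmul, smul_smul, smul_smul, ha]
  simp only [smul_add, smul_smul]
  ring_nf
  abel

lemma exists_pow_mul_prime_pow_eq {R : Type*} [Ring R] {p : ℕ} (hp : p.Prime) {s : ℕ}
    (hs : 1 ≤ s) (hcase : Odd p ∨ 2 ≤ s) {M B : R} {m : ℕ}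
    (hB : M ^ m = 1 + ((p : ℤ) ^ s) • B) (i : ℕ) :
    ∃ C : R, M ^ (m * p ^ i) = 1 + ((p : ℤ) ^ (s + i)) • (B + (p : ℤ) • C) := by
  induction i with
  | zero => exact ⟨0, by simpa using hB⟩
  | succ i ih =>
    obtain ⟨C, hC⟩ := ih
    obtain ⟨D, hD⟩ := exists_one_add_prime_pow_smul_pow hp (t := s + i) (by lia)
      (hcase.imp_right (by lia)) (B + (p : ℤ) • C)
    refine ⟨C + D, ?_⟩
    rw [pow_succ, ← mul_assoc, pow_mul, hC, hD, smul_add (p : ℤ) C D, add_assoc B, add_assoc s]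

/-- plateau phenomenon, odd case. Let `M ∈ Mat(d,ℤ)` not be of finite
order, let `p` be a prime not dividing `det M`, and write `M^{ord(M,p)} = 𝟙 + p^s B` with
`s ≥ 1` and `B ≢ 0 (mod p)`. If `p` is odd or `s ≥ 2`, then `ord(M, p^i) = ord(M, p)` for
`1 ≤ i ≤ s`, and `ord(M, p^{s+i}) = p^i · ord(M, p^s)` for all `i ≥ 1`. -/
theorem matrix_order_plateau_odd
    (d : ℕ) (M : Matrix (Fin d) (Fin d) ℤ)
    (hfin : ∀ k : ℕ, 1 ≤ k → M ^ k ≠ 1)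
    (p : ℕ) (hp : p.Prime) (hdet : ¬ ((p : ℤ) ∣ M.det))
    (s : ℕ) (hs : 1 ≤ s) (B : Matrix (Fin d) (Fin d) ℤ)
    (hB : M ^ matOrd M p = 1 + ((p : ℤ) ^ s) • B)
    (hBnz : B.map (Int.cast : ℤ → ZMod p) ≠ 0)
    (hcase : Odd p ∨ 2 ≤ s) :
    (∀ i : ℕ, 1 ≤ i → i ≤ s → matOrd M (p ^ i) = matOrd M p) ∧
    (∀ i : ℕ, 1 ≤ i → matOrd M (p ^ (s + i)) = p ^ i * matOrd M (p ^ s)) := by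
  have hm : matOrd M p ≠ 0 := by
    intro h
    rw [h, pow_zero, left_eq_add,
      smul_eq_zero_iff_right (pow_ne_zero _ (Int.natCast_ne_zero.2 hp.ne_zero))] at hB
    exact hBnz (by rw [hB]; ext; simp)
  have hplateau (i : ℕ) (h1 : 1 ≤ i) (hi : i ≤ s) : matOrd M (p ^ i) = matOrd M p := by
    refine Nat.dvd_antisymm ?_ (matOrd_dvd_matOrd M (dvd_pow_self p (by lia)))
    refine (matOrd_dvd_matOrd M (pow_dvd_pow p hi)).trans ((matOrd_dvd_iff M _ _).2 ⟨B, ?_⟩)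
    exact_mod_cast hB
  refine ⟨hplateau, fun i _ ↦ ?_⟩
  rw [hplateau s hs le_rfl]
  have hdvd : matOrd M (p ^ (s + i)) ∣ matOrd M p * p ^ i := by
    obtain ⟨C, hC⟩ := exists_pow_mul_prime_pow_eq hp hs hcase hB i
    exact (matOrd_dvd_iff M _ _).2 ⟨_, mod_cast hC⟩
  obtain ⟨k, hk⟩ := matOrd_dvd_matOrd M (dvd_pow_self p (show s + i ≠ 0 by lia))
  rw [hk] at hdvd
  obtain ⟨j, hji, rfl⟩ :=
    (Nat.dvd_prime_pow hp).1 (Nat.dvd_of_mul_dvd_mul_left (Nat.pos_of_ne_zero hm) hdvd)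
  obtain rfl | hlt := hji.eq_or_lt
  · rw [hk, mul_comm]
  obtain ⟨C, hC⟩ := exists_pow_mul_prime_pow_eq hp hs hcase hB j
  obtain ⟨D, hD⟩ := (matOrd_dvd_iff M (p ^ (s + i)) _).1 hk.dvd
  obtain ⟨r, rfl⟩ := Nat.exists_eq_add_of_lt hlt
  rw [hC, add_right_inj, show ((p ^ (s + (j + r + 1)) : ℕ) : ℤ) =
    (p : ℤ) ^ (s + j) * (p * p ^ r) by push_cast; ring, mul_smul] at hD
  have hBC := smul_right_injective _
    (pow_ne_zero (s + j) (Int.natCast_ne_zero.2 hp.ne_zero)) hD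
  refine absurd ((Matrix.map_intCast_eq_zero_iff B p).2 ⟨(p : ℤ) ^ r • D - C, ?_⟩) hBnz
  rw [smul_sub, smul_smul, ← hBC, add_sub_cancel_right]
end

section
/- Let M ∈ Mat(d,ℤ) be reversible mod n for infinitely many integers n ≥ 1. Then det(M) = 1 or det(M) = −1. -/
/-- An integer matrix `M` is *reversible mod `n`* if its reduction mod `n` is invertible and
is conjugate, within `GL(d, ℤ/nℤ)`, to its inverse. -/
def ReversibleMod (d n : ℕ) (M : Matrix (Fin d) (Fin d) ℤ) : Prop :=
  IsUnit (M.map (Int.cast : ℤ → ZMod n)).det ∧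
  ∃ A : Matrix (Fin d) (Fin d) (ZMod n), IsUnit A.det ∧
    A * M.map (Int.cast : ℤ → ZMod n) * A⁻¹ = (M.map (Int.cast : ℤ → ZMod n))⁻¹

/-- If `M` is reversible mod `n`, then `n` divides `(det M)² - 1`. -/
theorem ReversibleMod.dvd_det_sq_sub_one {d n : ℕ} {M : Matrix (Fin d) (Fin d) ℤ}
    (h : ReversibleMod d n M) : (n : ℤ) ∣ M.det ^ 2 - 1 := by
  obtain ⟨hM, A, hA, hconj⟩ := h
  have hdet : (M.map (Int.cast : ℤ → ZMod n)).det = (M.det : ZMod n) :=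
    ((Int.castRingHom (ZMod n)).map_det M).symm
  have hinv : (M.map (Int.cast : ℤ → ZMod n))⁻¹.det = (M.det : ZMod n) := by
    rw [← hconj, Matrix.det_conj ((Matrix.isUnit_iff_isUnit_det A).2 hA), hdet]
  have hsq : (M.det : ZMod n) * (M.det : ZMod n) = 1 := by
    have := Matrix.det_nonsing_inv_mul_det _ hM
    rwa [hinv, hdet] at this
  rw [← ZMod.intCast_zmod_eq_zero_iff_dvd, Int.cast_sub, Int.cast_pow, Int.cast_one, sq, hsq,
    sub_self]

/-- If `M ∈ Mat(d,ℤ)` is reversible mod `n` for infinitely many `n ≥ 1`,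
then `det M = 1` or `det M = −1`. -/
theorem det_eq_pm_one_of_reversible_for_infinitely_many
    (d : ℕ) (M : Matrix (Fin d) (Fin d) ℤ)
    (hinf : {n : ℕ | 1 ≤ n ∧ ReversibleMod d n M}.Infinite) :
    M.det = 1 ∨ M.det = -1 := by
  have hzero : M.det ^ 2 - 1 = 0 := by
    by_contra hne
    obtain ⟨n, ⟨-, hrev⟩, hlt⟩ := hinf.exists_gt (M.det ^ 2 - 1).natAbs
    have hle := Nat.le_of_dvd (Int.natAbs_pos.2 hne)
      (Int.natCast_dvd.1 hrev.dvd_det_sq_sub_one)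
    omega
  exact sq_eq_one_iff.1 (sub_eq_zero.1 hzero)
end

section
/- Let M ∈ Mat(2,ℤ) with det(M) ≡ −1 (mod n) be reversible mod n. Then 2·trace(M) ≡ 0 (mod n). In particular, trace(M) ≡ 0 (mod n) whenever n is odd. -/
/-- The inverse of a `2 × 2` matrix of determinant `-1` has the opposite trace. -/
theorem Matrix.trace_inv_of_det_eq_neg_one {R : Type*} [CommRing R]
    (B : Matrix (Fin 2) (Fin 2) R) (h : B.det = -1) : B⁻¹.trace = -B.trace := by
  have hinv : Ring.inverse (-1 : R) = -1 := by
    simpa using Ring.inverse_unit (-1 : Rˣ)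
  rw [Matrix.inv_def, h, hinv, Matrix.adjugate_fin_two, Matrix.trace_smul,
    Matrix.trace_fin_two, Matrix.trace_fin_two]
  simp [add_comm]

/-- A `2 × 2` matrix of determinant `-1` that is conjugate to its inverse satisfies
`2 * trace = 0`. -/
theorem Matrix.two_mul_trace_eq_zero_of_conj_eq_inv {R : Type*} [CommRing R]
    {A B : Matrix (Fin 2) (Fin 2) R} (hA : IsUnit A.det) (h : B.det = -1)
    (hconj : A * B * A⁻¹ = B⁻¹) : 2 * B.trace = 0 := by
  have htr : B.trace = -B.trace := by
    rw [← Matrix.trace_inv_of_det_eq_neg_one B h, ← hconj, Matrix.trace_mul_cycle,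
      Matrix.nonsing_inv_mul A hA, one_mul]
  linear_combination htr

/-- If `M ∈ Mat(2,ℤ)` with `det M ≡ −1 (mod n)` is reversible mod `n`,
then `2·trace M ≡ 0 (mod n)`; in particular `trace M ≡ 0 (mod n)` when `n` is odd. -/
theorem two_trace_eq_zero_of_reversible_det_neg_one
    (n : ℕ) (hn : 1 ≤ n) (M : Matrix (Fin 2) (Fin 2) ℤ)
    (hdet : (M.det : ZMod n) = -1)
    (hrev : ReversibleMod 2 n M) :
    ((2 * M.trace : ℤ) : ZMod n) = 0 ∧ (Odd n → ((M.trace : ℤ) : ZMod n) = 0) := by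
  obtain ⟨-, A, hA, hconj⟩ := hrev
  have hB : (M.map (Int.cast : ℤ → ZMod n)).det = -1 := by
    rw [← hdet, Int.cast_det]
  have htrace : (M.map (Int.cast : ℤ → ZMod n)).trace = ((M.trace : ℤ) : ZMod n) := by
    simp [Matrix.trace_fin_two]
  have h := Matrix.two_mul_trace_eq_zero_of_conj_eq_inv hA hB hconj
  rw [htrace] at h
  refine ⟨by exact_mod_cast h, fun hodd => ?_⟩
  have h2 : IsUnit (2 : ZMod n) := by
    exact_mod_cast (ZMod.isUnit_iff_coprime 2 n).mpr hodd.coprime_two_left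
  exact h2.mul_right_eq_zero.mp h
end

section
/- Let p be an odd prime and r ≥ 1. If M ∈ Mat(d,ℤ) is reversible mod p^r, then det(M) ≡ 1 (mod p^r) or det(M) ≡ −1 (mod p^r). Moreover, for d = 2 and M ∈ Mat(2,ℤ) whose reduction mod p^r is invertible, M is reversible mod p^r if and only if det(M) ≡ 1 (mod p^r) or M² ≡ 𝟙 (mod p^r). -/
section PreValuationRing

variable {R : Type*} [CommRing R]

theorem IsLocalRing.eq_one_or_eq_neg_one_of_mul_self_eq_one [IsLocalRing R]
    (h2 : IsUnit (2 : R)) {u : R} (hu : u * u = 1) : u = 1 ∨ u = -1 := by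
  have h : IsUnit ((u + 1) + (1 - u)) := by
    convert h2 using 1
    ring
  rcases IsLocalRing.isUnit_or_isUnit_of_isUnit_add h with h | h
  · left
    apply h.mul_left_cancel
    linear_combination hu
  · right
    apply h.mul_left_cancel
    linear_combination -hu

theorem Matrix.det_mul_det_eq_one_of_conj_eq_inv {n : Type*} [Fintype n] [DecidableEq n]
    {A M : Matrix n n R} (hM : IsUnit M.det) (hA : IsUnit A.det) (h : A * M * A⁻¹ = M⁻¹) :
    M.det * M.det = 1 := by
  have h1 : M.det = M⁻¹.det := by rw [← h, Matrix.det_conj ((Matrix.isUnit_iff_isUnit_det A).2 hA)]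
  nth_rewrite 2 [h1]
  rw [← Matrix.det_mul, Matrix.mul_nonsing_inv M hM, Matrix.det_one]

/-- Over a local ring whose divisibility order is total, a binary linear relation with
coefficients `x`, `b`, `c` is solved by the entries of an invertible traceless matrix. -/
theorem IsLocalRing.exists_isUnit_sq_add_mul [IsLocalRing R] [PreValuationRing R] (x b c : R) :
    ∃ u v w : R, u * x + v * c + w * b = 0 ∧ IsUnit (u * u + v * w) := by
  have key_b (hx : b ∣ x) : ∃ u v w : R, u * x + v * c + w * b = 0 ∧ IsUnit (u * u + v * w) := by
    obtain ⟨s, rfl⟩ := hx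
    exact ⟨1, 0, -s, by ring, by simp⟩
  have key_c (hx : c ∣ x) : ∃ u v w : R, u * x + v * c + w * b = 0 ∧ IsUnit (u * u + v * w) := by
    obtain ⟨s, rfl⟩ := hx
    exact ⟨1, -s, 0, by ring, by simp⟩
  obtain hb | hb := ValuationRing.dvd_total b x
  · exact key_b hb
  obtain hc | hc := ValuationRing.dvd_total c x
  · exact key_c hc
  obtain ⟨s, rfl⟩ := hb
  obtain ⟨t, rfl⟩ := hc
  by_cases hs : IsUnit s
  · exact key_b (hs.dvd_mul_right.1 dvd_rfl)
  by_cases ht : IsUnit t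
  · exact key_c (ht.dvd_mul_right.1 dvd_rfl)
  refine ⟨-(s + t), 1, 1, by ring, ?_⟩
  have hst : ¬ IsUnit (-(s + t) * -(s + t)) := fun h =>
    IsLocalRing.nonunits_add hs ht (IsUnit.neg_iff _ |>.1 (isUnit_of_mul_isUnit_left h))
  have h : IsUnit (-(s + t) * -(s + t) + 1 * 1 + -(-(s + t) * -(s + t))) := by
    ring_nf
    exact isUnit_one
  exact (IsLocalRing.isUnit_or_isUnit_of_isUnit_add h).resolve_right fun h => hst (by simpa using h)

theorem Matrix.exists_conj_eq_inv_of_det_eq_one [IsLocalRing R] [PreValuationRing R]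
    {M : Matrix (Fin 2) (Fin 2) R} (hM : M.det = 1) :
    ∃ A : Matrix (Fin 2) (Fin 2) R, IsUnit A.det ∧ A * M * A⁻¹ = M⁻¹ := by
  obtain ⟨u, v, w, h, hu⟩ := IsLocalRing.exists_isUnit_sq_add_mul (M 0 0 - M 1 1) (M 0 1) (M 1 0)
  have hA : IsUnit (!![u, v; w, -u]).det := by
    rw [Matrix.det_fin_two_of]
    convert hu.neg using 1
    ring
  refine ⟨!![u, v; w, -u], hA, ?_⟩
  have hconj : !![u, v; w, -u] * M = M.adjugate * !![u, v; w, -u] := by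
    rw [Matrix.adjugate_fin_two, Matrix.eta_fin_two M]
    ext i j
    fin_cases i <;> fin_cases j <;> simp [Matrix.mul_apply, Fin.sum_univ_two] <;>
      first | linear_combination h | ring
  rw [hconj, Matrix.mul_nonsing_inv_cancel_right _ _ hA, Matrix.inv_def, hM]
  simp

theorem Matrix.sq_eq_one_of_conj_eq_inv_of_det_eq_neg_one (h2 : IsUnit (2 : R))
    {A M : Matrix (Fin 2) (Fin 2) R} (hA : IsUnit A.det) (h : A * M * A⁻¹ = M⁻¹)
    (hM : M.det = -1) : M ^ 2 = 1 := by
  have hinv : M⁻¹ = -M.adjugate := by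
    apply Matrix.inv_eq_right_inv
    rw [mul_neg, Matrix.mul_adjugate, hM]
    simp
  have htr : M.trace = -M.adjugate.trace := by
    rw [← Matrix.trace_neg, ← hinv, ← h, Matrix.trace_mul_comm, ← mul_assoc,
      Matrix.nonsing_inv_mul A hA, one_mul]
  have h0 : M 0 0 + M 1 1 = 0 := by
    apply h2.mul_left_cancel
    rw [Matrix.adjugate_fin_two] at htr
    simp only [Matrix.trace_fin_two, Matrix.of_apply, Matrix.cons_val', Matrix.cons_val_zero,
      Matrix.cons_val_one, Matrix.cons_val_fin_one] at htr
    linear_combination htr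
  have hadj : M.adjugate = -M := by
    rw [Matrix.adjugate_fin_two]
    ext i j
    fin_cases i <;> fin_cases j <;> simp <;> linear_combination h0
  rw [hadj, neg_neg] at hinv
  have := Matrix.mul_nonsing_inv M (hM ▸ isUnit_one.neg)
  rwa [hinv, ← sq] at this

end PreValuationRing

instance ZMod.preValuationRing_prime_pow (p r : ℕ) [Fact p.Prime] :
    PreValuationRing (ZMod (p ^ r)) :=
  Function.Surjective.preValuationRing
    ((PadicInt.toZModPow (p := p) r : ℤ_[p] →* ZMod (p ^ r)) : ℤ_[p] →ₙ* _)
    (ZMod.ringHom_surjective (PadicInt.toZModPow r))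

/-- Let `p ≠ 2` be a prime and `r ≥ 1`. If `M ∈ Mat(d,ℤ)` is reversible
mod `p^r`, then `det M ≡ ±1 (mod p^r)`. For `d = 2` and `M` invertible mod `p^r`, `M` is
reversible mod `p^r` iff `det M ≡ 1 (mod p^r)` or `M² ≡ 𝟙 (mod p^r)`. -/
theorem reversible_mod_odd_prime_power
    (p : ℕ) (hp : p.Prime) (hodd : Odd p) (r : ℕ) (hr : 1 ≤ r) :
    (∀ d : ℕ, ∀ M : Matrix (Fin d) (Fin d) ℤ, ReversibleMod d (p ^ r) M →
      (M.det : ZMod (p ^ r)) = 1 ∨ (M.det : ZMod (p ^ r)) = -1) ∧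
    (∀ M : Matrix (Fin 2) (Fin 2) ℤ,
      IsUnit (M.map (Int.cast : ℤ → ZMod (p ^ r))).det →
      (ReversibleMod 2 (p ^ r) M ↔
        ((M.det : ZMod (p ^ r)) = 1 ∨ (M ^ 2).map (Int.cast : ℤ → ZMod (p ^ r)) = 1))) := by
  have : Fact p.Prime := ⟨hp⟩
  have : Fact (1 < p ^ r) := ⟨Nat.one_lt_pow (by omega) hp.one_lt⟩
  have : IsLocalRing (ZMod (p ^ r)) :=
    IsLocalRing.of_surjective' (PadicInt.toZModPow (p := p) r) (ZMod.ringHom_surjective _)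
  have h2 : IsUnit (2 : ZMod (p ^ r)) := by
    exact_mod_cast (ZMod.isUnit_iff_coprime 2 (p ^ r)).2 (Nat.coprime_two_left.2 hodd.pow)
  have hdet (d : ℕ) (M : Matrix (Fin d) (Fin d) ℤ) :
      (M.det : ZMod (p ^ r)) = (M.map (Int.cast : ℤ → ZMod (p ^ r))).det :=
    Int.cast_det M
  have hpm (d : ℕ) (M : Matrix (Fin d) (Fin d) ℤ) (hM : ReversibleMod d (p ^ r) M) :
      (M.det : ZMod (p ^ r)) = 1 ∨ (M.det : ZMod (p ^ r)) = -1 := by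
    obtain ⟨hM, A, hA, h⟩ := hM
    rw [hdet]
    exact IsLocalRing.eq_one_or_eq_neg_one_of_mul_self_eq_one h2
      (Matrix.det_mul_det_eq_one_of_conj_eq_inv hM hA h)
  refine ⟨hpm, fun M hM => ?_⟩
  have hsq : (M ^ 2).map (Int.cast : ℤ → ZMod (p ^ r)) =
      M.map (Int.cast : ℤ → ZMod (p ^ r)) ^ 2 :=
    Matrix.map_pow M (Int.castRingHom (ZMod (p ^ r))) 2
  rw [hsq]
  constructor
  · intro h
    refine (hpm 2 M h).imp_right fun h1 => ?_
    obtain ⟨-, A, hA, h⟩ := h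
    exact Matrix.sq_eq_one_of_conj_eq_inv_of_det_eq_neg_one h2 hA h (hdet 2 M ▸ h1)
  · rintro (h | h)
    · exact ⟨hM, Matrix.exists_conj_eq_inv_of_det_eq_one (hdet 2 M ▸ h)⟩
    · refine ⟨hM, 1, by simp, ?_⟩
      rw [inv_one, one_mul, mul_one, Matrix.inv_eq_right_inv (by rwa [← sq])]
end

section
/- Let p be a prime, r ≥ 1, d ≥ 1, and let M ∈ Mat(d, ℤ/p^rℤ) act linearly on the module (ℤ/p^rℤ)^d. Let m be the smallest nonnegative integer with ker(M^m) = ker(M^{m+1}) (equivalently, ker(M^{m+j}) = ker(M^m) for all j ≥ 0). If |ker(M)| = p, then |ker(M^i)| = p^{min(i,m)} for all i ≥ 0; in particular, |ker(M^{i+1})| = p·|ker(M^i)| for all 0 ≤ i < m. -/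
/-- If `f` is an endomorphism of a finite module whose kernel has prime order `p`, then each
step of the chain of iterated kernels either is trivial or multiplies the cardinality by `p`. -/
theorem Module.End.card_ker_pow_succ_of_card_ker_eq_prime {R V : Type*} [Ring R]
    [AddCommGroup V] [Module R V] [Finite V] {p : ℕ} (hp : p.Prime) (f : Module.End R V)
    (hf : Nat.card (LinearMap.ker f) = p) (i : ℕ)
    (hi : LinearMap.ker (f ^ i) ≠ LinearMap.ker (f ^ (i + 1))) :
    Nat.card (LinearMap.ker (f ^ (i + 1))) = p * Nat.card (LinearMap.ker (f ^ i)) := by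
  have hle : LinearMap.ker (f ^ i) ≤ LinearMap.ker (f ^ (i + 1)) := fun x hx => by
    rw [LinearMap.mem_ker] at hx ⊢
    rw [pow_succ', Module.End.mul_apply, hx, map_zero]
  let g : LinearMap.ker (f ^ (i + 1)) →ₗ[R] LinearMap.ker f :=
    LinearMap.codRestrict _ ((f ^ i).domRestrict _) fun x =>
      (LinearMap.congr_fun (pow_succ' f i) (x : V)).symm.trans x.2
  have hg : LinearMap.ker g = (LinearMap.ker (f ^ i)).submoduleOf _ :=
    (LinearMap.ker_codRestrict _ _ _).trans (LinearMap.ker_domRestrict _ _)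
  have hk : Nat.card (LinearMap.ker g) = Nat.card (LinearMap.ker (f ^ i)) := by
    rw [hg]
    exact Nat.card_congr (Submodule.submoduleOfEquivOfLe hle).toEquiv
  have hmul := Submodule.card_eq_card_quotient_mul_card (LinearMap.ker g)
  rw [hk, Nat.card_congr g.quotKerEquivRange.toEquiv] at hmul
  have hdvd : Nat.card (LinearMap.range g) ∣ p :=
    hf ▸ AddSubgroup.card_addSubgroup_dvd_card (LinearMap.range g).toAddSubgroup
  rcases (Nat.dvd_prime hp).1 hdvd with h1 | h1
  · rw [h1] at hmul
    refine absurd (SetLike.coe_injective (Set.eq_of_subset_of_ncard_le hle ?_)) hi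
    simpa [← Nat.card_coe_set_eq] using hmul.le
  · rw [hmul, h1, mul_comm]

/-- If two consecutive iterated kernels agree, the chain is constant from there on. -/
theorem Module.End.ker_pow_eq_of_ker_pow_eq_succ {R V : Type*} [Semiring R]
    [AddCommMonoid V] [Module R V] (f : Module.End R V) {k : ℕ}
    (h : LinearMap.ker (f ^ k) = LinearMap.ker (f ^ (k + 1))) (j : ℕ) :
    LinearMap.ker (f ^ (k + j)) = LinearMap.ker (f ^ k) := by
  induction j with
  | zero => rfl
  | succ j ih =>
    rw [← ih, show k + (j + 1) = k + 1 + j by ring, pow_add f (k + 1), pow_add f k j,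
      Module.End.mul_eq_comp, Module.End.mul_eq_comp, LinearMap.ker_comp, LinearMap.ker_comp, h]

/-- Let `p` be a prime, `r ≥ 1`, `d ≥ 1`, and let
`M ∈ Mat(d, ℤ/p^rℤ)` act on `(ℤ/p^rℤ)^d`. Let `m` be the smallest nonnegative integer
with `ker(M^m) = ker(M^{m+1})`. If `|ker M| = p`, then `|ker(M^i)| = p^{min(i,m)}` for all
`i ≥ 0`; in particular `|ker(M^{i+1})| = p·|ker(M^i)|` for `0 ≤ i < m`. -/
theorem card_ker_pow_of_card_ker_eq_p
    (p r d : ℕ) (hp : p.Prime) (hr : 1 ≤ r) (hd : 1 ≤ d)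
    (M : Matrix (Fin d) (Fin d) (ZMod (p ^ r)))
    (m : ℕ)
    (hm : m = sInf {j : ℕ |
      LinearMap.ker ((M ^ j).mulVecLin) = LinearMap.ker ((M ^ (j + 1)).mulVecLin)})
    (hker : Nat.card (LinearMap.ker M.mulVecLin) = p) :
    (∀ i : ℕ, Nat.card (LinearMap.ker ((M ^ i).mulVecLin)) = p ^ min i m) ∧
    (∀ i : ℕ, i < m →
      Nat.card (LinearMap.ker ((M ^ (i + 1)).mulVecLin))
        = p * Nat.card (LinearMap.ker ((M ^ i).mulVecLin))) := by
  have : Fact p.Prime := ⟨hp⟩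
  set f : Module.End (ZMod (p ^ r)) (Fin d → ZMod (p ^ r)) := M.mulVecLin
  have hpow (i : ℕ) : (M ^ i).mulVecLin = f ^ i := by
    simpa only [Matrix.toLin'_apply'] using Matrix.toLin'_pow M i
  simp only [hpow] at hm ⊢
  have hne : {j : ℕ | LinearMap.ker (f ^ j) = LinearMap.ker (f ^ (j + 1))}.Nonempty := by
    obtain ⟨n, hn⟩ := monotone_stabilizes_iff_noetherian.2 inferInstance f.iterateKer
    exact ⟨n, hn (n + 1) n.le_succ⟩
  have hstab := f.ker_pow_eq_of_ker_pow_eq_succ (k := m) (hm ▸ Nat.sInf_mem hne)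
  have hstep (i : ℕ) (hi : i < m) :
      Nat.card (LinearMap.ker (f ^ (i + 1))) = p * Nat.card (LinearMap.ker (f ^ i)) :=
    Module.End.card_ker_pow_succ_of_card_ker_eq_prime hp f hker i
      fun h => Nat.notMem_of_lt_sInf (hm ▸ hi) h
  have hlow (i : ℕ) (hi : i ≤ m) : Nat.card (LinearMap.ker (f ^ i)) = p ^ i := by
    induction i with
    | zero => simp [Module.End.one_eq_id]
    | succ i ih => rw [hstep i hi, ih (Nat.le_of_succ_le hi), pow_succ']
  refine ⟨fun i => ?_, hstep⟩
  rcases le_total i m with hi | hi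
  · rw [min_eq_left hi, hlow i hi]
  · obtain ⟨k, rfl⟩ := Nat.exists_eq_add_of_le hi
    rw [min_eq_right hi, hstab k, hlow m le_rfl]
end
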